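/- The bar map is an involution: bar(bar(x)) = x for all x ∈ Λ_A. -/

import Mathlib

noncomputable section

/-- The ring `A = ℤ[q,q⁻¹]` of integer Laurent polynomials. -/
abbrev AL : Type := LaurentPolynomial ℤ

/-- The quantum parameter `q ∈ A`. -/
def qA : AL := LaurentPolynomial.T 1

/-- `q⁻¹ ∈ A`. -/
def qAinv : AL := LaurentPolynomial.T (-1)

/-- The index set `I = {1,…,n} ∪ {−n,…,−1}` as a finset of integers. -/
def Iset (n : ℕ) : Finset ℤ := (Finset.Icc (-(n : ℤ)) (n : ℤ)).erase 0

/-- The type of generators, indexed by `I`. -/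
abbrev Gen (n : ℕ) : Type := {x : ℤ // x ∈ Iset n}

/-- The generator of the free algebra indexed by `x ∈ I` (junk value `0` otherwise). -/
def gn (n : ℕ) (x : ℤ) : FreeAlgebra AL (Gen n) :=
  if h : x ∈ Iset n then FreeAlgebra.ι AL (⟨x, h⟩ : Gen n) else 0

/-- The defining relations of the quantum exterior algebra of type C. -/
inductive CRel (n : ℕ) : FreeAlgebra AL (Gen n) → FreeAlgebra AL (Gen n) → Prop
  | sq (x : ℤ) (hx : x ∈ Iset n) : CRel n (gn n x * gn n x) 0
  | posSwap (i j : ℕ) (h1 : 1 ≤ i) (h2 : i < j) (h3 : j ≤ n) :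
      CRel n (gn n (j : ℤ) * gn n (i : ℤ)) ((-qA) • (gn n (i : ℤ) * gn n (j : ℤ)))
  | negSwap (i j : ℕ) (h1 : 1 ≤ i) (h2 : i < j) (h3 : j ≤ n) :
      CRel n (gn n (-(i : ℤ)) * gn n (-(j : ℤ))) ((-qA) • (gn n (-(j : ℤ)) * gn n (-(i : ℤ))))
  | mixSwap (i j : ℕ) (h1 : 1 ≤ i) (h2 : i ≤ n) (h3 : 1 ≤ j) (h4 : j ≤ n) (h5 : i ≠ j) :
      CRel n (gn n (-(i : ℤ)) * gn n (j : ℤ)) ((-qA) • (gn n (j : ℤ) * gn n (-(i : ℤ))))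
  | main (i : ℕ) (h1 : 1 ≤ i) (h2 : i ≤ n) :
      CRel n (gn n (-(i : ℤ)) * gn n (i : ℤ))
        ((-(qA ^ 2)) • (gn n (i : ℤ) * gn n (-(i : ℤ))) +
          (qA - qAinv) •
            ∑ k ∈ Finset.Icc 1 (n - i),
              ((-qA) ^ (k + 1)) • (gn n ((i + k : ℕ) : ℤ) * gn n (-((i + k : ℕ) : ℤ))))

/-- The quantum exterior algebra of type C, `Λ_A`. -/
abbrev LamAlg (n : ℕ) : Type := RingQuot (CRel n)

/-- The generator `v_x ∈ Λ_A`. -/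
def va (n : ℕ) (x : ℤ) : LamAlg n := RingQuot.mkAlgHom AL (CRel n) (gn n x)

/-- The minimum of a nonempty finset of integers with respect to the order of `I`
(positives first, then negatives). -/
def iMin (S : Finset ℤ) (h : S.Nonempty) : ℤ :=
  if hp : (S.filter (fun x => 0 < x)).Nonempty then (S.filter (fun x => 0 < x)).min' hp
  else S.min' h

theorem iMin_mem (S : Finset ℤ) (h : S.Nonempty) : iMin S h ∈ S := by
  unfold iMin
  split
  · exact Finset.mem_of_mem_filter _ (Finset.min'_mem _ _)
  · exact Finset.min'_mem _ _

/-- The maximum of a nonempty finset of integers with respect to the order of `I`. -/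
def iMax (S : Finset ℤ) (h : S.Nonempty) : ℤ :=
  if hp : (S.filter (fun x => x < 0)).Nonempty then (S.filter (fun x => x < 0)).max' hp
  else S.max' h

theorem iMax_mem (S : Finset ℤ) (h : S.Nonempty) : iMax S h ∈ S := by
  unfold iMax
  split
  · exact Finset.mem_of_mem_filter _ (Finset.max'_mem _ _)
  · exact Finset.max'_mem _ _

/-- The standard monomial `v_S = v_{x_1} v_{x_2} ⋯ v_{x_m}` for `S = {x_1 < ⋯ < x_m}`
(in the order of `I`). -/
def vset (n : ℕ) (S : Finset ℤ) : LamAlg n :=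
  if h : S.Nonempty then va n (iMin S h) * vset n (S.erase (iMin S h)) else 1
termination_by S.card
decreasing_by exact Finset.card_erase_lt_of_mem (iMin_mem S h)

/-- The reversed standard monomial `v_S^{rev} = v_{x_m} ⋯ v_{x_2} v_{x_1}`. -/
def vsetRev (n : ℕ) (S : Finset ℤ) : LamAlg n :=
  if h : S.Nonempty then va n (iMax S h) * vsetRev n (S.erase (iMax S h)) else 1
termination_by S.card
decreasing_by exact Finset.card_erase_lt_of_mem (iMax_mem S h)

/-- `−S`. -/
def negSet (S : Finset ℤ) : Finset ℤ := S.image (fun x => -x)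

/-- The scalar (-1/q)^(card choose 2) (1/q)^(half the number of fully dotted entries) appearing in the definition of
the bar map. -/
def barScalar (S : Finset ℤ) : AL :=
  (-qAinv) ^ (S.card * (S.card - 1) / 2) *
    LaurentPolynomial.T (-(((S ∩ negSet S).card / 2 : ℕ) : ℤ))

/-! ### Monomials and the straightening algorithm -/

/-- The monomial `v_{x_1} ⋯ v_{x_m}` attached to an arbitrary list of indices. -/
def word (n : ℕ) (l : List ℤ) : LamAlg n := (l.map (va n)).prod

theorem word_nil (n : ℕ) : word n [] = 1 := rfl

theorem word_cons (n : ℕ) (x : ℤ) (l : List ℤ) : word n (x :: l) = va n x * word n l := by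
  simp [word]

theorem word_append (n : ℕ) (l m : List ℤ) : word n (l ++ m) = word n l * word n m := by
  simp [word]

/-- The order of `I`: positive indices first, then negative ones. -/
def ltI (x y : ℤ) : Prop := (0 < x ∧ y < 0) ∨ ((0 < x ↔ 0 < y) ∧ x < y)

theorem mem_Iset {n : ℕ} {x : ℤ} : x ∈ Iset n ↔ x ≠ 0 ∧ -(n : ℤ) ≤ x ∧ x ≤ n := by
  simp [Iset]

theorem vset_toFinset (n : ℕ) (l : List ℤ) (h0 : ∀ x ∈ l, x ≠ 0) (hl : l.Pairwise ltI) :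
    vset n l.toFinset = word n l := by
  induction l with
  | nil => rw [vset]; simp [word_nil]
  | cons x t ih =>
    rw [List.pairwise_cons] at hl
    have hne : (x :: t).toFinset.Nonempty := ⟨x, by simp⟩
    have hx0 := h0 x (by simp)
    have hmin : iMin (x :: t).toFinset hne = x := by
      unfold iMin
      split
      · next hp =>
        by_cases hx : 0 < x
        · refine le_antisymm (Finset.min'_le _ _ (by simp [hx])) (Finset.le_min' _ _ _ ?_)
          intro y hy
          simp only [List.toFinset_cons, Finset.mem_filter, Finset.mem_insert,
            List.mem_toFinset] at hy
          rcases hy with ⟨rfl | hy, hy'⟩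
          · exact le_rfl
          · rcases hl.1 y hy with h | h <;> omega
        · obtain ⟨y, hy⟩ := hp
          simp only [List.toFinset_cons, Finset.mem_filter, Finset.mem_insert,
            List.mem_toFinset] at hy
          rcases hy with ⟨rfl | hy, hy'⟩
          · omega
          · rcases hl.1 y hy with h | h <;> omega
      · next hp =>
        refine le_antisymm (Finset.min'_le _ _ (by simp)) (Finset.le_min' _ _ _ ?_)
        intro y hy
        have hx : ¬ 0 < x := fun h => hp ⟨x, by simp [h]⟩
        simp only [List.toFinset_cons, Finset.mem_insert, List.mem_toFinset] at hy
        rcases hy with rfl | hy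
        · exact le_rfl
        · rcases hl.1 y hy with h | h <;> omega
    have hxt : x ∉ t := fun h => by rcases hl.1 x h with h | h <;> omega
    rw [vset, dif_pos hne, hmin, word_cons, ← ih (fun y hy => h0 y (by simp [hy])) hl.2]
    congr 2
    rw [List.toFinset_cons, Finset.erase_insert (by simpa using hxt)]

theorem vsetRev_toFinset (n : ℕ) (l : List ℤ) (h0 : ∀ x ∈ l, x ≠ 0) (hl : l.Pairwise ltI) :
    vsetRev n l.toFinset = word n l.reverse := by
  induction l using List.reverseRecOn with
  | nil => rw [vsetRev]; simp [word_nil]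
  | append_singleton t x ih =>
    rw [List.pairwise_append] at hl
    have hl1 : ∀ y ∈ t, ltI y x := fun y hy => hl.2.2 y hy x (by simp)
    have hne : (t ++ [x]).toFinset.Nonempty := ⟨x, by simp⟩
    have hx0 := h0 x (by simp)
    have hmax : iMax (t ++ [x]).toFinset hne = x := by
      unfold iMax
      split
      · next hp =>
        by_cases hx : x < 0
        · refine le_antisymm (Finset.max'_le _ _ _ ?_) (Finset.le_max' _ _ (by simp [hx]))
          intro y hy
          simp only [List.toFinset_append, List.toFinset_cons, List.toFinset_nil,
            Finset.mem_filter, Finset.mem_union, Finset.mem_insert, Finset.notMem_empty, or_false,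
            List.mem_toFinset] at hy
          rcases hy with ⟨hy | rfl, hy'⟩
          · rcases hl1 y hy with h | h <;> omega
          · exact le_rfl
        · obtain ⟨y, hy⟩ := hp
          simp only [List.toFinset_append, List.toFinset_cons, List.toFinset_nil,
            Finset.mem_filter, Finset.mem_union, Finset.mem_insert, Finset.notMem_empty, or_false,
            List.mem_toFinset] at hy
          rcases hy with ⟨hy | rfl, hy'⟩
          · rcases hl1 y hy with h | h <;> omega
          · omega
      · next hp =>
        refine le_antisymm (Finset.max'_le _ _ _ ?_) (Finset.le_max' _ _ (by simp))
        intro y hy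
        have hx : ¬ x < 0 := fun h => hp ⟨x, by simp [h]⟩
        simp only [List.toFinset_append, List.toFinset_cons, List.toFinset_nil,
          Finset.mem_union, Finset.mem_insert, Finset.notMem_empty, or_false,
          List.mem_toFinset] at hy
        rcases hy with hy | rfl
        · rcases hl1 y hy with h | h <;> omega
        · exact le_rfl
    have hxt : x ∉ t := fun h => by rcases hl1 x h with h | h <;> omega
    rw [vsetRev, dif_pos hne, hmax, List.reverse_append, List.reverse_singleton,
      List.singleton_append, word_cons, ← ih (fun y hy => h0 y (by simp [hy])) hl.1]
    congr 2
    ext y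
    simp only [List.toFinset_append, List.toFinset_cons, List.toFinset_nil, Finset.mem_erase,
      Finset.mem_union, Finset.mem_insert, Finset.notMem_empty, or_false, List.mem_toFinset]
    constructor
    · rintro ⟨h1, h2 | h2⟩
      · exact h2
      · exact absurd h2 h1
    · intro h
      exact ⟨fun e => hxt (e ▸ h), Or.inl h⟩

/-- The elements of `S`, listed increasingly in the order of `I`. -/
def sortI (S : Finset ℤ) : List ℤ :=
  (S.filter (fun x => 0 < x)).sort (· ≤ ·) ++ (S.filter (fun x => x < 0)).sort (· ≤ ·)

theorem sortI_pairwise (S : Finset ℤ) : (sortI S).Pairwise ltI := by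
  unfold sortI
  rw [List.pairwise_append]
  refine ⟨?_, ?_, ?_⟩
  · refine List.Pairwise.imp_of_mem ?_ (Finset.sortedLT_sort _).pairwise
    intro a b ha hb hab
    simp only [Finset.mem_sort, Finset.mem_filter] at ha hb
    exact Or.inr ⟨by simp [ha.2, hb.2], hab⟩
  · refine List.Pairwise.imp_of_mem ?_ (Finset.sortedLT_sort _).pairwise
    intro a b ha hb hab
    simp only [Finset.mem_sort, Finset.mem_filter] at ha hb
    exact Or.inr ⟨by omega, hab⟩
  · intro a ha b hb
    simp only [Finset.mem_sort, Finset.mem_filter] at ha hb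
    exact Or.inl ⟨ha.2, hb.2⟩

theorem mem_sortI {S : Finset ℤ} (h0 : (0 : ℤ) ∉ S) {x : ℤ} : x ∈ sortI S ↔ x ∈ S := by
  unfold sortI
  simp only [List.mem_append, Finset.mem_sort, Finset.mem_filter]
  constructor
  · rintro (h | h) <;> exact h.1
  · intro h
    have : x ≠ 0 := fun e => h0 (e ▸ h)
    rcases lt_or_gt_of_ne this with h' | h'
    · exact Or.inr ⟨h, h'⟩
    · exact Or.inl ⟨h, h'⟩

theorem sortI_nodup (S : Finset ℤ) : (sortI S).Nodup :=
  (sortI_pairwise S).imp (fun {a b} h => by rcases h with h | h <;> omega)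

theorem sortI_toFinset {S : Finset ℤ} (h0 : (0 : ℤ) ∉ S) : (sortI S).toFinset = S := by
  ext x
  rw [List.mem_toFinset, mem_sortI h0]

theorem vset_eq_word (n : ℕ) {S : Finset ℤ} (h0 : (0 : ℤ) ∉ S) :
    vset n S = word n (sortI S) := by
  conv_lhs => rw [← sortI_toFinset h0]
  exact vset_toFinset n _ (fun x hx e => h0 (e ▸ (mem_sortI h0).1 hx)) (sortI_pairwise S)

theorem vsetRev_eq_word (n : ℕ) {S : Finset ℤ} (h0 : (0 : ℤ) ∉ S) :
    vsetRev n S = word n (sortI S).reverse := by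
  conv_lhs => rw [← sortI_toFinset h0]
  exact vsetRev_toFinset n _ (fun x hx e => h0 (e ▸ (mem_sortI h0).1 hx)) (sortI_pairwise S)

theorem zero_notMem_of_subset {n : ℕ} {S : Finset ℤ} (hS : S ⊆ Iset n) : (0 : ℤ) ∉ S :=
  fun h => (mem_Iset.1 (hS h)).1 rfl

/-! ### The defining relations in `Λ_A` -/

theorem qA_mul_qAinv : qA * qAinv = 1 := by
  rw [qA, qAinv, ← LaurentPolynomial.T_add]; simp

theorem va_sq (n : ℕ) {x : ℤ} (hx : x ∈ Iset n) : va n x * va n x = 0 := by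
  have := RingQuot.mkAlgHom_rel AL (CRel.sq x hx)
  simpa [va] using this

theorem va_posSwap {n i j : ℕ} (h1 : 1 ≤ i) (h2 : i < j) (h3 : j ≤ n) :
    va n j * va n i = (-qA) • (va n i * va n j) := by
  have := RingQuot.mkAlgHom_rel AL (CRel.posSwap i j h1 h2 h3)
  simpa only [va, map_mul, map_smul] using this

theorem va_negSwap {n i j : ℕ} (h1 : 1 ≤ i) (h2 : i < j) (h3 : j ≤ n) :
    va n (-(i : ℤ)) * va n (-(j : ℤ)) = (-qA) • (va n (-(j : ℤ)) * va n (-(i : ℤ))) := by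
  have := RingQuot.mkAlgHom_rel AL (CRel.negSwap i j h1 h2 h3)
  simpa only [va, map_mul, map_smul] using this

theorem va_mixSwap {n i j : ℕ} (h1 : 1 ≤ i) (h2 : i ≤ n) (h3 : 1 ≤ j) (h4 : j ≤ n) (h5 : i ≠ j) :
    va n (-(i : ℤ)) * va n j = (-qA) • (va n j * va n (-(i : ℤ))) := by
  have := RingQuot.mkAlgHom_rel AL (CRel.mixSwap i j h1 h2 h3 h4 h5)
  simpa only [va, map_mul, map_smul] using this

theorem va_main {n i : ℕ} (h1 : 1 ≤ i) (h2 : i ≤ n) :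
    va n (-(i : ℤ)) * va n i = (-(qA ^ 2)) • (va n i * va n (-(i : ℤ))) +
      (qA - qAinv) • ∑ k ∈ Finset.Icc 1 (n - i),
        ((-qA) ^ (k + 1)) • (va n ((i + k : ℕ) : ℤ) * va n (-((i + k : ℕ) : ℤ))) := by
  have := RingQuot.mkAlgHom_rel AL (CRel.main i h1 h2)
  simpa only [va, map_mul, map_smul, map_add, map_sum] using this

theorem smul_swap {n : ℕ} {a b : LamAlg n} (h : a = (-qA) • b) : b = (-qAinv) • a := by
  rw [h, smul_smul]
  have : -qAinv * -qA = 1 := by linear_combination qA_mul_qAinv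
  rw [this, one_smul]

/-- Generators whose indices have the same sign commute up to a scalar. -/
theorem exists_va_comm {n : ℕ} {x y : ℤ} (hx : x ∈ Iset n) (hy : y ∈ Iset n)
    (hxy : 0 < x ↔ 0 < y) : ∃ c : AL, va n x * va n y = c • (va n y * va n x) := by
  have key : ∀ {x y : ℤ}, x ∈ Iset n → y ∈ Iset n → (0 < x ↔ 0 < y) → x < y →
      va n y * va n x = (-qA) • (va n x * va n y) := by
    intro x y hx hy hxy hlt
    rw [mem_Iset] at hx hy
    by_cases h : 0 < x
    · lift x to ℕ using h.le
      lift y to ℕ using (hxy.1 h).le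
      exact va_posSwap (by omega) (by omega) (by omega)
    · obtain ⟨x, rfl⟩ : ∃ i : ℤ, x = -i := ⟨-x, by simp⟩
      obtain ⟨y, rfl⟩ : ∃ i : ℤ, y = -i := ⟨-y, by simp⟩
      lift x to ℕ using (by omega)
      lift y to ℕ using (by omega)
      exact va_negSwap (by omega) (by omega) (by omega)
  rcases lt_trichotomy x y with h | rfl | h
  · exact ⟨_, smul_swap (key hx hy hxy h)⟩
  · exact ⟨1, (one_smul _ _).symm⟩
  · exact ⟨_, key hy hx hxy.symm h⟩

/-- Monomials in generators of the same sign can be permuted up to a scalar. -/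
theorem exists_word_perm {n : ℕ} {l m : List ℤ} (h : l.Perm m) :
    (∀ x ∈ l, x ∈ Iset n) → (∀ x ∈ l, ∀ y ∈ l, 0 < x ↔ 0 < y) →
      ∃ c : AL, word n l = c • word n m := by
  induction h with
  | nil => exact fun _ _ => ⟨1, (one_smul _ _).symm⟩
  | cons x _ ih =>
    intro hI hs
    obtain ⟨c, hc⟩ := ih (fun y hy => hI y (by simp [hy]))
      (fun y hy z hz => hs y (by simp [hy]) z (by simp [hz]))
    exact ⟨c, by rw [word_cons, word_cons, hc, mul_smul_comm]⟩
  | swap x y l =>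
    intro hI hs
    obtain ⟨c, hc⟩ := exists_va_comm (hI y (by simp)) (hI x (by simp))
      (hs y (by simp) x (by simp))
    exact ⟨c, by simp only [word_cons, ← mul_assoc, hc, smul_mul_assoc]⟩
  | trans h1 _ ih1 ih2 =>
    intro hI hs
    obtain ⟨c, hc⟩ := ih1 hI hs
    obtain ⟨d, hd⟩ := ih2 (fun x hx => hI x (h1.mem_iff.2 hx))
      (fun x hx y hy => hs x (h1.mem_iff.2 hx) y (h1.mem_iff.2 hy))
    exact ⟨c * d, by rw [hc, hd, smul_smul]⟩

theorem word_eq_zero_of_not_nodup {n : ℕ} {l : List ℤ} (hI : ∀ x ∈ l, x ∈ Iset n)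
    (hs : ∀ x ∈ l, ∀ y ∈ l, 0 < x ↔ 0 < y) (hl : ¬ l.Nodup) : word n l = 0 := by
  rw [← List.exists_duplicate_iff_not_nodup] at hl
  obtain ⟨x, hx⟩ := hl
  rw [List.duplicate_iff_sublist] at hx
  obtain ⟨t, ht⟩ := hx.exists_perm_append
  obtain ⟨c, hc⟩ := exists_word_perm ht hI hs
  rw [hc]
  simp only [List.cons_append, List.nil_append, word_cons, ← mul_assoc]
  rw [va_sq n (hI x (ht.mem_iff.2 (by simp)))]
  simp

/-! ### The weight grading -/

/-- The weight of a monomial: `v_x` and `v_{-x}` have opposite weights. -/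
def weight (l : List ℤ) (x : ℤ) : ℤ := (l.count x : ℤ) - l.count (-x)

theorem weight_append (l m : List ℤ) : weight (l ++ m) = weight l + weight m := by
  ext x; simp [weight]; ring

theorem weight_cons (x : ℤ) (l : List ℤ) : weight (x :: l) = weight [x] + weight l :=
  weight_append [x] l

theorem weight_perm {l m : List ℤ} (h : l.Perm m) : weight l = weight m := by
  ext x; simp [weight, h.count_eq]

theorem weight_pair (x : ℤ) : weight [x, -x] = 0 := by
  ext y
  simp only [weight, List.count_cons, List.count_nil, beq_iff_eq, Pi.zero_apply]
  split_ifs <;> omega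

/-- The span of the monomials of given degree and weight whose positive indices come first. -/
def triSpan (n d : ℕ) (w : ℤ → ℤ) : Submodule AL (LamAlg n) :=
  Submodule.span AL {m | ∃ l₁ l₂ : List ℤ, (∀ x ∈ l₁, x ∈ Iset n ∧ 0 < x) ∧
    (∀ x ∈ l₂, x ∈ Iset n ∧ x < 0) ∧ l₁.length + l₂.length = d ∧
    weight l₁ + weight l₂ = w ∧ word n l₁ * word n l₂ = m}

/-- The span of the standard monomials of given degree and weight. -/
def stdSpan (n d : ℕ) (w : ℤ → ℤ) : Submodule AL (LamAlg n) :=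
  Submodule.span AL {m | ∃ S : Finset ℤ, S ⊆ Iset n ∧ S.card = d ∧ weight (sortI S) = w ∧
    vset n S = m}

theorem va_mul_mem_triSpan_of_pos {n d : ℕ} {w : ℤ → ℤ} {x : ℤ} (hx : x ∈ Iset n) (h : 0 < x)
    {m : LamAlg n} (hm : m ∈ triSpan n d w) : va n x * m ∈ triSpan n (d + 1) (weight [x] + w) := by
  unfold triSpan at hm
  induction hm using Submodule.span_induction with
  | mem m hm =>
    obtain ⟨l₁, l₂, h1, h2, rfl, rfl, rfl⟩ := hm
    refine Submodule.subset_span ⟨x :: l₁, l₂, ?_, h2, ?_, ?_, ?_⟩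
    · intro y hy
      rcases List.mem_cons.1 hy with rfl | hy
      · exact ⟨hx, h⟩
      · exact h1 y hy
    · simp; omega
    · rw [weight_cons, add_assoc]
    · rw [word_cons, mul_assoc]
  | zero => simp
  | add a b _ _ ha hb => rw [mul_add]; exact add_mem ha hb
  | smul c a _ ha => rw [mul_smul_comm]; exact Submodule.smul_mem _ _ ha

/-- A negative generator times a positive one is a combination of products
positive times negative of the same weight. -/
theorem neg_mul_pos_mem_span {n : ℕ} {x y : ℤ} (hx : x ∈ Iset n) (hx0 : x < 0) (hy : y ∈ Iset n)
    (hy0 : 0 < y) : va n x * va n y ∈ Submodule.span AL {m | ∃ a b : ℤ, (a ∈ Iset n ∧ 0 < a) ∧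
      (b ∈ Iset n ∧ b < 0) ∧ weight [a] + weight [b] = weight [x] + weight [y] ∧
      va n a * va n b = m} := by
  have hx' := mem_Iset.1 hx
  have hy' := mem_Iset.1 hy
  obtain ⟨i, rfl⟩ : ∃ i : ℤ, x = -i := ⟨-x, by simp⟩
  lift i to ℕ using (by omega)
  lift y to ℕ using hy0.le
  by_cases hij : i = y
  · subst hij
    have hw : ∀ z : ℤ, weight [z] + weight [-z] = 0 := fun z => by
      rw [← weight_append]; exact weight_pair z
    rw [va_main (by omega) (by omega)]
    refine add_mem (Submodule.smul_mem _ _ (Submodule.subset_span ?_))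
      (Submodule.smul_mem _ _ (Submodule.sum_mem _ fun k hk => Submodule.smul_mem _ _
        (Submodule.subset_span ?_)))
    · exact ⟨_, _, ⟨hy, hy0⟩, ⟨hx, hx0⟩, add_comm _ _, rfl⟩
    · rw [Finset.mem_Icc] at hk
      refine ⟨_, _, ⟨?_, ?_⟩, ⟨?_, ?_⟩, ?_, rfl⟩
      · rw [mem_Iset]; omega
      · omega
      · rw [mem_Iset]; omega
      · omega
      · rw [hw, add_comm, hw]
  · rw [va_mixSwap (by omega) (by omega) (by omega) (by omega) hij]
    exact Submodule.smul_mem _ _ (Submodule.subset_span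
      ⟨_, _, ⟨hy, hy0⟩, ⟨hx, hx0⟩, add_comm _ _, rfl⟩)

theorem va_mul_word_mem_triSpan_of_neg {n : ℕ} (l₁ l₂ : List ℤ)
    (h1 : ∀ x ∈ l₁, x ∈ Iset n ∧ 0 < x) (h2 : ∀ x ∈ l₂, x ∈ Iset n ∧ x < 0) :
    ∀ x : ℤ, x ∈ Iset n → x < 0 → va n x * (word n l₁ * word n l₂) ∈
      triSpan n (l₁.length + l₂.length + 1) (weight [x] + (weight l₁ + weight l₂)) := by
  induction l₁ with
  | nil =>
    intro x hx hx0
    refine Submodule.subset_span ⟨[], x :: l₂, by simp, ?_, by simp, ?_, ?_⟩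
    · intro y hy
      rcases List.mem_cons.1 hy with rfl | hy
      · exact ⟨hx, hx0⟩
      · exact h2 y hy
    · rw [weight_cons x]; abel
    · simp [word_nil, word_cons]
  | cons y t ih =>
    intro x hx hx0
    have ih := ih (fun z hz => h1 z (by simp [hz]))
    obtain ⟨hy, hy0⟩ := h1 y (by simp)
    have e : va n x * (word n (y :: t) * word n l₂) =
        (va n x * va n y) * (word n t * word n l₂) := by
      rw [word_cons]; simp only [mul_assoc]
    rw [e]
    have key := neg_mul_pos_mem_span hx hx0 hy hy0
    generalize va n x * va n y = p at key ⊢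
    induction key using Submodule.span_induction with
    | mem m hm =>
      obtain ⟨a, b, ⟨ha, ha0⟩, ⟨hb, hb0⟩, hw, rfl⟩ := hm
      have := va_mul_mem_triSpan_of_pos ha ha0 (ih b hb hb0)
      rw [mul_assoc]
      convert this using 2
      · simp only [List.length_cons]; omega
      · rw [weight_cons y, ← add_assoc (weight [a]), hw]; abel
    | zero => simp
    | add a b _ _ ha hb => rw [add_mul]; exact add_mem ha hb
    | smul c a _ ha => rw [smul_mul_assoc]; exact Submodule.smul_mem _ _ ha

theorem word_mem_triSpan {n : ℕ} (l : List ℤ) (hl : ∀ x ∈ l, x ∈ Iset n) :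
    word n l ∈ triSpan n l.length (weight l) := by
  induction l with
  | nil =>
    exact Submodule.subset_span ⟨[], [], by simp, by simp, rfl, by ext; simp [weight],
      by simp [word_nil]⟩
  | cons x t ih =>
    have ih := ih (fun z hz => hl z (by simp [hz]))
    have hx := hl x (by simp)
    rw [word_cons, weight_cons, List.length_cons]
    rcases lt_or_gt_of_ne (mem_Iset.1 hx).1 with h | h
    · unfold triSpan at ih
      generalize word n t = p at ih ⊢
      induction ih using Submodule.span_induction with
      | mem m hm =>
        obtain ⟨l₁, l₂, h1, h2, hd, hw, rfl⟩ := hm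
        rw [← hd, ← hw]
        exact va_mul_word_mem_triSpan_of_neg l₁ l₂ h1 h2 x hx h
      | zero => simp
      | add a b _ _ ha hb => rw [mul_add]; exact add_mem ha hb
      | smul c a _ ha => rw [mul_smul_comm]; exact Submodule.smul_mem _ _ ha
    · exact va_mul_mem_triSpan_of_pos hx h ih

theorem triSpan_le_stdSpan (n d : ℕ) (w : ℤ → ℤ) : triSpan n d w ≤ stdSpan n d w := by
  refine Submodule.span_le.2 ?_
  rintro _ ⟨l₁, l₂, h1, h2, rfl, rfl, rfl⟩
  have hs1 : ∀ x ∈ l₁, ∀ y ∈ l₁, 0 < x ↔ 0 < y := fun x hx y hy => by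
    have := h1 x hx; have := h1 y hy; omega
  have hs2 : ∀ x ∈ l₂, ∀ y ∈ l₂, 0 < x ↔ 0 < y := fun x hx y hy => by
    have := h2 x hx; have := h2 y hy; omega
  by_cases hn1 : l₁.Nodup
  swap
  · rw [word_eq_zero_of_not_nodup (fun x hx => (h1 x hx).1) hs1 hn1, zero_mul]
    exact zero_mem _
  by_cases hn2 : l₂.Nodup
  swap
  · rw [word_eq_zero_of_not_nodup (fun x hx => (h2 x hx).1) hs2 hn2, mul_zero]
    exact zero_mem _
  set S : Finset ℤ := (l₁ ++ l₂).toFinset with hSdef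
  have hmem : ∀ x, x ∈ S ↔ x ∈ l₁ ∨ x ∈ l₂ := fun x => by simp [hSdef]
  have hSI : S ⊆ Iset n := fun x hx => by
    rcases (hmem x).1 hx with h | h
    · exact (h1 x h).1
    · exact (h2 x h).1
  have hp1 : l₁.Perm ((S.filter (fun x => 0 < x)).sort (· ≤ ·)) := by
    rw [List.perm_ext_iff_of_nodup hn1 (Finset.sort_nodup _ _)]
    intro x
    rw [Finset.mem_sort, Finset.mem_filter, hmem]
    constructor
    · exact fun h => ⟨Or.inl h, (h1 x h).2⟩
    · rintro ⟨h | h, h'⟩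
      · exact h
      · have := (h2 x h).2; omega
  have hp2 : l₂.Perm ((S.filter (fun x => x < 0)).sort (· ≤ ·)) := by
    rw [List.perm_ext_iff_of_nodup hn2 (Finset.sort_nodup _ _)]
    intro x
    rw [Finset.mem_sort, Finset.mem_filter, hmem]
    constructor
    · exact fun h => ⟨Or.inr h, (h2 x h).2⟩
    · rintro ⟨h | h, h'⟩
      · have := (h1 x h).2; omega
      · exact h
  have hp : (l₁ ++ l₂).Perm (sortI S) := hp1.append hp2
  obtain ⟨c, hc⟩ := exists_word_perm hp1 (fun x hx => (h1 x hx).1) hs1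
  obtain ⟨d, hd⟩ := exists_word_perm hp2 (fun x hx => (h2 x hx).1) hs2
  rw [hc, hd, smul_mul_smul_comm, ← word_append]
  refine Submodule.smul_mem _ _ (Submodule.subset_span ⟨S, hSI, ?_, ?_, ?_⟩)
  · rw [← List.length_append, hp.length_eq, ← List.toFinset_card_of_nodup (sortI_nodup S),
      sortI_toFinset (zero_notMem_of_subset hSI)]
  · rw [← weight_append, weight_perm hp]
  · exact vset_eq_word n (zero_notMem_of_subset hSI)

/-- Every monomial is a combination of standard monomials of the same degree and weight. -/
theorem word_mem_stdSpan {n : ℕ} (l : List ℤ) (hl : ∀ x ∈ l, x ∈ Iset n) :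
    word n l ∈ stdSpan n l.length (weight l) :=
  triSpan_le_stdSpan _ _ _ (word_mem_triSpan l hl)

theorem mem_span_word {n : ℕ} (x : LamAlg n) :
    x ∈ Submodule.span AL {m | ∃ l : List ℤ, (∀ x ∈ l, x ∈ Iset n) ∧ word n l = m} := by
  obtain ⟨y, rfl⟩ := RingQuot.mkAlgHom_surjective AL (CRel n) x
  induction y using FreeAlgebra.induction with
  | grade0 r =>
    rw [AlgHom.commutes, Algebra.algebraMap_eq_smul_one]
    exact Submodule.smul_mem _ _ (Submodule.subset_span ⟨[], by simp, word_nil n⟩)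
  | grade1 g =>
    refine Submodule.subset_span ⟨[g.1], by simp [g.2], ?_⟩
    rw [word_cons, word_nil, mul_one, va, gn, dif_pos g.2]
  | mul a b ha hb =>
    rw [map_mul]
    have := Submodule.mul_mem_mul ha hb
    rw [Submodule.span_mul_span] at this
    refine Submodule.span_mono ?_ this
    rintro _ ⟨_, ⟨l, hl, rfl⟩, _, ⟨m, hm, rfl⟩, rfl⟩
    refine ⟨l ++ m, ?_, word_append n l m⟩
    intro x hx
    rcases List.mem_append.1 hx with h | h
    · exact hl x h
    · exact hm x h
  | add a b ha hb => rw [map_add]; exact add_mem ha hb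

/-- The standard monomials span `Λ_A`. -/
theorem mem_span_vset {n : ℕ} (x : LamAlg n) :
    x ∈ Submodule.span AL {m | ∃ S : Finset ℤ, S ⊆ Iset n ∧ vset n S = m} := by
  refine Submodule.span_le.2 ?_ (mem_span_word x)
  rintro _ ⟨l, hl, rfl⟩
  refine Submodule.span_mono ?_ (word_mem_stdSpan l hl)
  rintro _ ⟨S, hS, -, -, h⟩
  exact ⟨S, hS, h⟩

/-! ### The scalar of the bar map depends only on degree and weight -/

theorem card_inter_negSet {n : ℕ} {S : Finset ℤ} (hS : S ⊆ Iset n) :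
    (S ∩ negSet S).card + ((Iset n).filter (fun x => weight (sortI S) x = 1)).card = S.card := by
  have h0 := zero_notMem_of_subset hS
  have hw : ∀ x, weight (sortI S) x = (if x ∈ S then 1 else 0) - (if -x ∈ S then 1 else 0) := by
    intro x
    simp only [weight, List.Nodup.count (sortI_nodup S), mem_sortI h0]
    push_cast
    rfl
  have hneg : ∀ x, x ∈ negSet S ↔ -x ∈ S := by
    intro x
    simp only [negSet, Finset.mem_image]
    constructor
    · rintro ⟨a, ha, rfl⟩; simpa using ha
    · intro h; exact ⟨-x, h, by simp⟩
  have : (Iset n).filter (fun x => weight (sortI S) x = 1) = S \ negSet S := by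
    ext x
    rw [Finset.mem_filter, Finset.mem_sdiff, hneg, hw]
    by_cases h1 : x ∈ S <;> by_cases h2 : -x ∈ S <;> simp [h1, h2]
    exact hS h1
  rw [this, Finset.card_inter_add_card_sdiff]

theorem barScalar_congr {n : ℕ} {S T : Finset ℤ} (hS : S ⊆ Iset n) (hT : T ⊆ Iset n)
    (hc : S.card = T.card) (hw : weight (sortI S) = weight (sortI T)) :
    barScalar S = barScalar T := by
  have h1 := card_inter_negSet hS
  have h2 := card_inter_negSet hT
  rw [hw] at h1
  have : (S ∩ negSet S).card = (T ∩ negSet T).card := by omega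
  rw [barScalar, barScalar, hc, this]

theorem invert_qA : LaurentPolynomial.invert qA = qAinv := by
  rw [qA, qAinv, LaurentPolynomial.invert_T]

theorem invert_qAinv : LaurentPolynomial.invert qAinv = qA := by
  rw [qA, qAinv, LaurentPolynomial.invert_T, neg_neg]

theorem invert_barScalar_mul (S : Finset ℤ) :
    LaurentPolynomial.invert (barScalar S) * barScalar S = 1 := by
  rw [barScalar, map_mul, map_pow, map_neg, invert_qAinv, LaurentPolynomial.invert_T,
    mul_mul_mul_comm, ← mul_pow, ← LaurentPolynomial.T_add]
  simp [qA_mul_qAinv]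

/-! ### The reversal anti-automorphism -/

/-- The opposite algebra of `Λ_A`, with `A` acting through `q ↦ q⁻¹`. -/
def RevAlg (n : ℕ) : Type := (LamAlg n)ᵐᵒᵖ

instance (n : ℕ) : Ring (RevAlg n) := inferInstanceAs (Ring (LamAlg n)ᵐᵒᵖ)

instance (n : ℕ) : Algebra AL (RevAlg n) :=
  Algebra.compHom (LamAlg n)ᵐᵒᵖ (LaurentPolynomial.invert (R := ℤ)).toRingHom

/-- The tautological additive identification of `RevAlg n` with `Λ_A`. -/
def ofRev (n : ℕ) : RevAlg n ≃+ LamAlg n := (MulOpposite.opAddEquiv (α := LamAlg n)).symm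

theorem ofRev_mul {n : ℕ} (a b : RevAlg n) : ofRev n (a * b) = ofRev n b * ofRev n a := rfl

theorem ofRev_one (n : ℕ) : ofRev n 1 = 1 := rfl

theorem ofRev_smul {n : ℕ} (g : AL) (a : RevAlg n) :
    ofRev n (g • a) = LaurentPolynomial.invert g • ofRev n a := rfl

/-- The image of the generator `v_x` under reversal. -/
def revGen (n : ℕ) (x : ℤ) : RevAlg n := (ofRev n).symm (va n x)

theorem ofRev_revGen (n : ℕ) (x : ℤ) : ofRev n (revGen n x) = va n x :=
  (ofRev n).apply_symm_apply _

/-- Reversal on the free algebra. -/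
def revFree (n : ℕ) : FreeAlgebra AL (Gen n) →ₐ[AL] RevAlg n :=
  FreeAlgebra.lift AL (fun x => revGen n x.1)

theorem va_of_notMem {n : ℕ} {x : ℤ} (hx : x ∉ Iset n) : va n x = 0 := by
  rw [va, gn, dif_neg hx, map_zero]

theorem revFree_gn (n : ℕ) (x : ℤ) : revFree n (gn n x) = revGen n x := by
  by_cases hx : x ∈ Iset n
  · rw [gn, dif_pos hx, revFree, FreeAlgebra.lift_ι_apply]
  · rw [gn, dif_neg hx, map_zero, revGen, va_of_notMem hx, map_zero]

theorem sum_Icc_one_eq {M : Type*} [AddCommMonoid M] (m : ℕ) (f : ℕ → M) :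
    ∑ k ∈ Finset.Icc 1 m, f k = ∑ k ∈ Finset.range m, f (k + 1) := by
  rw [Finset.range_eq_Ico, Finset.sum_Ico_add' f 0 m 1]
  rfl

/-- The defining relation for `v_{-i} v_i` is compatible with `q ↦ q⁻¹` and reversal, on the
level of the correction terms. -/
theorem sum_neg_mul_pos (n : ℕ) (m i : ℕ) (h : i + m = n) :
    ∑ k ∈ Finset.range m, ((-qAinv) ^ (k + 2)) •
        (va n (-((i + (k + 1) : ℕ) : ℤ)) * va n ((i + (k + 1) : ℕ) : ℤ)) =
      (-(qAinv ^ 2)) • ∑ k ∈ Finset.range m, ((-qA) ^ (k + 2)) •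
        (va n ((i + (k + 1) : ℕ) : ℤ) * va n (-((i + (k + 1) : ℕ) : ℤ))) := by
  induction m generalizing i with
  | zero => simp
  | succ m ih =>
    have ih := ih (i + 1) (by omega)
    have hm := va_main (n := n) (i := i + 1) (by omega) (by omega)
    rw [show n - (i + 1) = m by omega, sum_Icc_one_eq] at hm
    have e : ∀ k, i + (k + 1 + 1) = i + 1 + (k + 1) := fun k => by omega
    have p : ∀ (c : AL) (k : ℕ), c ^ (k + 1 + 2) = c * c ^ (k + 2) := fun c k => by ring
    rw [Finset.sum_range_succ', Finset.sum_range_succ']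
    simp only [e, p, mul_smul, ← Finset.smul_sum]
    have p' : ∀ k : ℕ, k + 1 + 1 = k + 2 := fun _ => rfl
    simp only [p'] at hm
    simp only [zero_add]
    rw [ih, hm]
    match_scalars <;> ring

theorem va_main_reversed {n i : ℕ} (h1 : 1 ≤ i) (h2 : i ≤ n) :
    va n i * va n (-(i : ℤ)) = (-(qAinv ^ 2)) • (va n (-(i : ℤ)) * va n i) +
      (qAinv - qA) • ∑ k ∈ Finset.Icc 1 (n - i),
        ((-qAinv) ^ (k + 1)) • (va n (-((i + k : ℕ) : ℤ)) * va n ((i + k : ℕ) : ℤ)) := by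
  have hm := va_main h1 h2
  have hs := sum_neg_mul_pos n (n - i) i (by omega)
  rw [sum_Icc_one_eq] at hm ⊢
  have p : ∀ k : ℕ, k + 1 + 1 = k + 2 := fun _ => rfl
  simp only [p] at hm ⊢
  rw [hs, hm]
  have hq := qA_mul_qAinv
  match_scalars
  · linear_combination (-(qA * qAinv) - 1) * hq
  · ring

theorem revFree_rel (n : ℕ) {a b : FreeAlgebra AL (Gen n)} (h : CRel n a b) :
    revFree n a = revFree n b := by
  apply (ofRev n).injective
  cases h with
  | sq x hx => simp only [map_mul, revFree_gn, ofRev_mul, ofRev_revGen, va_sq n hx, map_zero]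
  | posSwap i j h1 h2 h3 =>
    simp only [map_mul, map_smul, revFree_gn, ofRev_mul, ofRev_smul, ofRev_revGen, map_neg,
      invert_qA]
    exact smul_swap (va_posSwap h1 h2 h3)
  | negSwap i j h1 h2 h3 =>
    simp only [map_mul, map_smul, revFree_gn, ofRev_mul, ofRev_smul, ofRev_revGen, map_neg,
      invert_qA]
    exact smul_swap (va_negSwap h1 h2 h3)
  | mixSwap i j h1 h2 h3 h4 h5 =>
    simp only [map_mul, map_smul, revFree_gn, ofRev_mul, ofRev_smul, ofRev_revGen, map_neg,
      invert_qA]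
    exact smul_swap (va_mixSwap h1 h2 h3 h4 h5)
  | main i h1 h2 =>
    simp only [map_mul, map_smul, map_add, map_sum, revFree_gn, ofRev_mul, ofRev_smul,
      ofRev_revGen, map_neg, map_sub, map_pow, invert_qA, invert_qAinv]
    exact va_main_reversed h1 h2

/-- The semilinear anti-automorphism of `Λ_A` fixing the generators. -/
def rev (n : ℕ) : LamAlg n →+ LamAlg n :=
  (ofRev n).toAddMonoidHom.comp
    (RingQuot.liftAlgHom AL ⟨revFree n, fun _ _ h => revFree_rel n h⟩ :
      LamAlg n →ₐ[AL] RevAlg n).toRingHom.toAddMonoidHom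

theorem rev_apply {n : ℕ} (x : LamAlg n) : rev n x =
    ofRev n ((RingQuot.liftAlgHom AL ⟨revFree n, fun _ _ h => revFree_rel n h⟩ :
      LamAlg n →ₐ[AL] RevAlg n) x) := rfl

theorem rev_mul {n : ℕ} (x y : LamAlg n) : rev n (x * y) = rev n y * rev n x := by
  rw [rev_apply, map_mul, ofRev_mul]; rfl

theorem rev_smul {n : ℕ} (g : AL) (x : LamAlg n) :
    rev n (g • x) = LaurentPolynomial.invert g • rev n x := by
  rw [rev_apply, map_smul, ofRev_smul]; rfl

theorem rev_va (n : ℕ) (x : ℤ) : rev n (va n x) = va n x := by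
  rw [rev_apply, va, RingQuot.liftAlgHom_mkAlgHom_apply, revFree_gn, ofRev_revGen, va]

theorem rev_word (n : ℕ) (l : List ℤ) : rev n (word n l) = word n l.reverse := by
  induction l with
  | nil => rw [List.reverse_nil, word_nil, rev_apply, map_one, ofRev_one]
  | cons x t ih =>
    rw [word_cons, rev_mul, ih, rev_va, List.reverse_cons, word_append, word_cons, word_nil,
      mul_one]

/-- On a homogeneous component, the bar map is a multiple of reversal. -/
theorem bar_eq_smul_rev {n : ℕ} (bar : LamAlg n →+ LamAlg n)
    (hbar1 : ∀ (g : AL) (x : LamAlg n), bar (g • x) = (LaurentPolynomial.invert g) • bar x)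
    (hbar2 : ∀ S : Finset ℤ, S ⊆ Iset n → bar (vset n S) = barScalar S • vsetRev n S)
    {S : Finset ℤ} (hS : S ⊆ Iset n) {x : LamAlg n}
    (hx : x ∈ stdSpan n S.card (weight (sortI S))) : bar x = barScalar S • rev n x := by
  unfold stdSpan at hx
  induction hx using Submodule.span_induction with
  | mem m hm =>
    obtain ⟨T, hT, hc, hw, rfl⟩ := hm
    have h0 := zero_notMem_of_subset hT
    rw [hbar2 T hT, barScalar_congr hT hS hc hw, vsetRev_eq_word n h0, vset_eq_word n h0, rev_word]
  | zero => simp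
  | add a b _ _ ha hb => rw [map_add, map_add, ha, hb, smul_add]
  | smul c a _ ha => rw [hbar1, ha, rev_smul, smul_comm]

/-- the bar map — the unique additive map with bar(g·x) = ḡ·bar(x) for
g ∈ A (where ḡ(q) = g(q⁻¹)) and bar(v_S) = (−q⁻¹)^{|S|(|S|−1)/2}(q⁻¹)^{|S∩(−S)|/2}·v_S^{rev}
— is an involution. -/
theorem stmt18 (n : ℕ) (hn : 1 ≤ n) (bar : LamAlg n →+ LamAlg n)
    (hbar1 : ∀ (g : AL) (x : LamAlg n), bar (g • x) = (LaurentPolynomial.invert g) • bar x)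
    (hbar2 : ∀ S : Finset ℤ, S ⊆ Iset n → bar (vset n S) = barScalar S • vsetRev n S) :
    ∀ x : LamAlg n, bar (bar x) = x := by
  intro x
  have hx := mem_span_vset x
  induction hx using Submodule.span_induction with
  | mem m hm =>
    obtain ⟨S, hS, rfl⟩ := hm
    have h0 := zero_notMem_of_subset hS
    have hmem : word n (sortI S).reverse ∈ stdSpan n S.card (weight (sortI S)) := by
      have h := word_mem_stdSpan (n := n) (sortI S).reverse
        (fun x hx => hS ((mem_sortI h0).1 (List.mem_reverse.1 hx)))
      rwa [weight_perm (List.reverse_perm _), List.length_reverse,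
        ← List.toFinset_card_of_nodup (sortI_nodup S), sortI_toFinset h0] at h
    rw [hbar2 S hS, hbar1, vsetRev_eq_word n h0, bar_eq_smul_rev bar hbar1 hbar2 hS hmem, rev_word,
      List.reverse_reverse, smul_smul, invert_barScalar_mul, one_smul, vset_eq_word n h0]
  | zero => simp
  | add a b _ _ ha hb => rw [map_add, map_add, ha, hb]
  | smul c a _ ha =>
    rw [hbar1, hbar1, ha, LaurentPolynomial.involutive_invert c]

end
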